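/- The group (ℤ/2ℤ)³ cannot be realized by a 3-net in ℙ²(ℂ): there do not exist injective maps p₁, p₂, p₃ : (ℤ/2ℤ)³ → ℙ²(ℂ) with pairwise disjoint images such that for all x,y,z ∈ (ℤ/2ℤ)³ the points p₁(x), p₂(y), p₃(z) are collinear if and only if x+y+z = 0. -/

import Mathlib

/-- The complex projective plane ℙ²(ℂ) = ℙ(ℂ³). -/
abbrev P2 : Type := Projectivization ℂ (Fin 3 → ℂ)

/-- Three points of ℙ²(ℂ) are collinear if representative vectors in ℂ³ span a linear
subspace of dimension at most 2. -/
def Collin (p q r : P2) : Prop :=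
  Module.finrank ℂ (Submodule.span ℂ {p.rep, q.rep, r.rep} : Submodule ℂ (Fin 3 → ℂ)) ≤ 2

/-- A realization of a finite abelian group `H` by a 3-net in ℙ²(ℂ), stated dually in
terms of the points dual to the lines of the net: three injective maps `H → ℙ²(ℂ)` with
pairwise disjoint images such that `p₁ x`, `p₂ y`, `p₃ z` are collinear iff
`x + y + z = 0`. -/
def Realizes {H : Type} [AddCommGroup H] (p₁ p₂ p₃ : H → P2) : Prop :=
  Function.Injective p₁ ∧ Function.Injective p₂ ∧ Function.Injective p₃ ∧
  Disjoint (Set.range p₁) (Set.range p₂) ∧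
  Disjoint (Set.range p₁) (Set.range p₃) ∧
  Disjoint (Set.range p₂) (Set.range p₃) ∧
  ∀ x y z : H, Collin (p₁ x) (p₂ y) (p₃ z) ↔ x + y + z = 0

abbrev V3 : Type := Fin 3 → ℂ

/-- The determinant of three vectors. -/
def d3 (u v w : V3) : ℂ :=
  u 0 * (v 1 * w 2 - v 2 * w 1) - u 1 * (v 0 * w 2 - v 2 * w 0) + u 2 * (v 0 * w 1 - v 1 * w 0)

/-- The cross product. -/
def cr (v w : V3) : V3 :=
  ![v 1 * w 2 - v 2 * w 1, v 2 * w 0 - v 0 * w 2, v 0 * w 1 - v 1 * w 0]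

theorem cramer (u v z w : V3) :
    d3 u v z • w = d3 w v z • u + d3 u w z • v + d3 u v w • z := by
  ext i; fin_cases i <;> simp [d3] <;> ring

theorem span2 {u v z w : V3} (h : d3 u v z ≠ 0) (h0 : d3 u v w = 0) :
    ∃ s t : ℂ, w = s • u + t • v := by
  refine ⟨(d3 u v z)⁻¹ * d3 w v z, (d3 u v z)⁻¹ * d3 u w z, ?_⟩
  have := cramer u v z w
  rw [h0, zero_smul, add_zero] at this
  rw [mul_smul, mul_smul, ← smul_add, ← this, inv_smul_smul₀ h]

theorem span3 {u v z : V3} (w : V3) (h : d3 u v z ≠ 0) :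
    ∃ s t r : ℂ, w = s • u + t • v + r • z := by
  refine ⟨(d3 u v z)⁻¹ * d3 w v z, (d3 u v z)⁻¹ * d3 u w z, (d3 u v z)⁻¹ * d3 u v w, ?_⟩
  rw [mul_smul, mul_smul, mul_smul, ← smul_add, ← smul_add, ← cramer u v z w, inv_smul_smul₀ h]

theorem perp {Q u v w : V3} (hQ : Q ≠ 0)
    (hu : u 0 * Q 0 + u 1 * Q 1 + u 2 * Q 2 = 0)
    (hv : v 0 * Q 0 + v 1 * Q 1 + v 2 * Q 2 = 0)
    (hw : w 0 * Q 0 + w 1 * Q 1 + w 2 * Q 2 = 0) : d3 u v w = 0 := by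
  by_contra hd
  apply hQ
  have h0 : d3 u v w * Q 0 = 0 := by
    unfold d3
    linear_combination (v 1 * w 2 - v 2 * w 1) * hu - (u 1 * w 2 - u 2 * w 1) * hv
      + (u 1 * v 2 - u 2 * v 1) * hw
  have h1 : d3 u v w * Q 1 = 0 := by
    unfold d3
    linear_combination -(v 0 * w 2 - v 2 * w 0) * hu + (u 0 * w 2 - u 2 * w 0) * hv
      - (u 0 * v 2 - u 2 * v 0) * hw
  have h2 : d3 u v w * Q 2 = 0 := by
    unfold d3
    linear_combination (v 0 * w 1 - v 1 * w 0) * hu - (u 0 * w 1 - u 1 * w 0) * hv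
      + (u 0 * v 1 - u 1 * v 0) * hw
  ext i
  fin_cases i
  · exact (mul_eq_zero.1 h0).resolve_left hd
  · exact (mul_eq_zero.1 h1).resolve_left hd
  · exact (mul_eq_zero.1 h2).resolve_left hd

/-- In a complete quadrilateral, the vertices `c₀`, `c₁` in terms of `a₀`, `b₀`, `b₁`. -/
theorem quad {a0 b0 b1 c0 c1 : V3} (h1 : d3 a0 b0 c0 = 0) (h2 : d3 a0 b1 c1 = 0)
    (h3 : d3 a0 b0 c1 ≠ 0) (h4 : d3 a0 b1 c0 ≠ 0) :
    ∃ p q r s : ℂ, c0 = p • a0 + q • b0 ∧ c1 = r • a0 + s • b1 ∧ q ≠ 0 ∧ s ≠ 0 ∧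
      d3 a0 b0 b1 ≠ 0 := by
  obtain ⟨p, q, hc0⟩ := span2 h3 h1
  obtain ⟨r, s, hc1⟩ := span2 h4 h2
  refine ⟨p, q, r, s, hc0, hc1, ?_, ?_, ?_⟩
  · rintro rfl; apply h4; rw [hc0]; simp [d3]; ring
  · rintro rfl; apply h3; rw [hc1]; simp [d3]; ring
  · intro h; apply h3
    have : d3 a0 b0 c1 = s * d3 a0 b0 b1 := by rw [hc1]; simp [d3]; ring
    rw [this, h, mul_zero]

theorem cr_cr {a0 b0 b1 n : V3} (p q r s : ℂ) :
    d3 n (cr b0 b1) (cr (p • a0 + q • b0) (r • a0 + s • b1)) =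
      d3 a0 b0 b1 * (r * q * (n 0 * b0 0 + n 1 * b0 1 + n 2 * b0 2)
        - p * s * (n 0 * b1 0 + n 1 * b1 1 + n 2 * b1 2)) := by
  simp [d3, cr]; ring

theorem key {a0 b0 b1 c0 c1 a a' b c : V3} (h1 : d3 a0 b0 c0 = 0) (h2 : d3 a0 b1 c1 = 0)
    (h3 : d3 a0 b0 c1 ≠ 0) (h4 : d3 a0 b1 c0 ≠ 0)
    (e1 : d3 a b c0 = 0) (e2 : d3 a' b c1 = 0) (e3 : d3 a b0 c = 0) (e4 : d3 a' b1 c = 0)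
    (e5 : d3 a0 b c = 0) (f1 : d3 a b0 c0 ≠ 0) (f2 : d3 a' b1 c1 ≠ 0)
    (f3 : d3 a b c1 ≠ 0) (f4 : d3 a b1 c ≠ 0) :
    d3 (cr a a') (cr b0 b1) (cr c0 c1) = 0 := by
  obtain ⟨p, q, r, s, rfl, rfl, hq, hs, hd⟩ := quad h1 h2 h3 h4
  obtain ⟨t, τ, rfl⟩ : ∃ t τ : ℂ, b = t • a + τ • (p • a0 + q • b0) := by
    apply span2 (z := b0)
    · intro h; apply f1; rw [← neg_eq_zero, ← h]; simp only [d3]; ring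
    · rw [← neg_eq_zero, ← e1]; simp only [d3]; ring
  obtain ⟨s', σ, rfl⟩ : ∃ t τ : ℂ, c = t • a + τ • b0 := span2 f1 e3
  have hτ : τ ≠ 0 := by
    rintro rfl; apply f3; simp [d3]; ring
  have hσ : σ ≠ 0 := by
    rintro rfl; apply f4; simp [d3]; ring
  have g5 : d3 a0 b0 a * (q * τ * s' - t * σ) = 0 := by
    rw [← e5]; simp [d3]; ring
  have g : d3 a0 b0 a ≠ 0 := by
    intro h; apply f1
    have : d3 a b0 (p • a0 + q • b0) = - p * d3 a0 b0 a := by simp [d3]; ring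
    rw [this, h, mul_zero]
  have g5' := (mul_eq_zero.1 g5).resolve_left g
  obtain ⟨x, y, z, rfl⟩ := span3 a' hd
  have hy : y ≠ 0 := by
    rintro rfl; apply f2; simp [d3]; ring
  rw [cr_cr]
  set n := cr a (x • a0 + y • b0 + z • b1) with hn
  obtain ⟨N0, hN0⟩ : ∃ N, N = n 0 * a0 0 + n 1 * a0 1 + n 2 * a0 2 := ⟨_, rfl⟩
  obtain ⟨N1, hN1⟩ : ∃ N, N = n 0 * b0 0 + n 1 * b0 1 + n 2 * b0 2 := ⟨_, rfl⟩
  obtain ⟨N2, hN2⟩ : ∃ N, N = n 0 * b1 0 + n 1 * b1 1 + n 2 * b1 2 := ⟨_, rfl⟩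
  have hsum : x * N0 + y * N1 + z * N2 = 0 := by
    rw [hN0, hN1, hN2, hn]; simp [cr]; ring
  have k2 : t * (r * N0 + s * N2) + τ * (d3 a0 b0 b1 * (-(s * q * x) + s * p * y + r * q * z)) = 0 := by
    rw [← neg_eq_zero, ← e2, hN0, hN2, hn]; simp [cr, d3]; ring
  have k4 : s' * N2 - σ * (d3 a0 b0 b1 * x) = 0 := by
    rw [← e4, hN2, hn]; simp [cr, d3]; ring
  rw [← hN1, ← hN2]
  generalize d3 a0 b0 b1 = D at *
  have : τ * σ * y * (D * (r * q * N1 - p * s * N2)) = 0 := by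
    linear_combination -(σ * N2 * k2 + (r * N0 + s * N2) * N2 * g5'
      - q * τ * (r * N0 + s * N2) * k4) + τ * σ * D * r * q * hsum
  exact (mul_eq_zero.1 this).resolve_left (mul_ne_zero (mul_ne_zero hτ hσ) hy)

theorem nonconc {a0 a1 b0 b1 c0 c1 : V3} (h1 : d3 a0 b0 c0 = 0) (h2 : d3 a0 b1 c1 = 0)
    (h3 : d3 a0 b0 c1 ≠ 0) (h4 : d3 a0 b1 c0 ≠ 0)
    (h5 : d3 a1 b0 c1 = 0) (h6 : d3 a1 b1 c0 = 0) (h7 : d3 a1 b0 c0 ≠ 0)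
    (h8 : d3 a1 b1 c1 ≠ 0) :
    d3 (cr a0 a1) (cr b0 b1) (cr c0 c1) ≠ 0 := by
  obtain ⟨p, q, r, s, rfl, rfl, hq, hs, hd⟩ := quad h1 h2 h3 h4
  obtain ⟨x, y, z, rfl⟩ := span3 a1 hd
  have k5 : d3 a0 b0 b1 * (x * s - z * r) = 0 := by
    rw [← h5]; simp [d3]; ring
  have k6 : d3 a0 b0 b1 * (y * p - x * q) = 0 := by
    rw [← h6]; simp [d3]; ring
  have k5' := (mul_eq_zero.1 k5).resolve_left hd
  have k6' := (mul_eq_zero.1 k6).resolve_left hd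
  have hp : p ≠ 0 := by
    rintro rfl; apply h7; simp [d3]; ring
  have hy : y ≠ 0 := by
    rintro rfl; apply h8; simp [d3]; ring
  rw [cr_cr]
  have : d3 a0 b0 b1 * (r * q * (cr a0 (x • a0 + y • b0 + z • b1) 0 * b0 0 +
      cr a0 (x • a0 + y • b0 + z • b1) 1 * b0 1 + cr a0 (x • a0 + y • b0 + z • b1) 2 * b0 2) -
      p * s * (cr a0 (x • a0 + y • b0 + z • b1) 0 * b1 0 +
      cr a0 (x • a0 + y • b0 + z • b1) 1 * b1 1 + cr a0 (x • a0 + y • b0 + z • b1) 2 * b1 2)) =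
      d3 a0 b0 b1 * (d3 a0 b0 b1 * (-(r * q * z) - p * s * y)) := by
    congr 1; simp [d3, cr]; ring
  rw [this]
  have : -(r * q * z) - p * s * y = -2 * p * s * y := by
    linear_combination q * k5' + s * k6'
  rw [this]
  simp [hd, hp, hs, hy]

abbrev E8 : Type := ZMod 2 × ZMod 2 × ZMod 2

theorem no_vectors (a b c : E8 → V3) (T : ∀ x y z, d3 (a x) (b y) (c z) = 0 ↔ x + y + z = 0) :
    False := by
  have K : ∀ x y z : E8, x + y + z ≠ 0 → x + y + z ≠ (1, 0, 0) →
      d3 (cr (a x) (a (x + (1, 0, 0)))) (cr (b y) (b (y + (1, 0, 0))))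
        (cr (c z) (c (z + (1, 0, 0)))) = 0 := by
    intro x y z n1 n2
    apply key (a0 := a (y + z)) (b := b (x + z)) (c := c (x + y)) <;>
      simp only [T, ne_eq] <;> revert x y z <;> decide
  have N : ∀ x y z : E8, x + y + z = 0 →
      d3 (cr (a x) (a (x + (1, 0, 0)))) (cr (b y) (b (y + (1, 0, 0))))
        (cr (c z) (c (z + (1, 0, 0)))) ≠ 0 := by
    intro x y z n1
    apply nonconc <;>
      simp only [T, ne_eq] <;> revert x y z <;> decide
  generalize hA : (fun x => cr (a x) (a (x + (1, 0, 0)))) = A at *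
  generalize hB : (fun x => cr (b x) (b (x + (1, 0, 0)))) = B at *
  generalize hC : (fun x => cr (c x) (c (x + (1, 0, 0)))) = C at *
  replace K : ∀ x y z : E8, x + y + z ≠ 0 → x + y + z ≠ (1, 0, 0) →
      d3 (A x) (B y) (C z) = 0 := by subst hA hB hC; exact K
  replace N : ∀ x y z : E8, x + y + z = 0 → d3 (A x) (B y) (C z) ≠ 0 := by
    subst hA hB hC; exact N
  -- the common point of the lines `A 0` and `A (0,1,0)`
  have inc : ∀ y z x : E8, x + y + z = 0 → y + z ≠ 0 → y + z ≠ (1, 0, 0) →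
      (0, 1, 0) + y + z ≠ 0 → (0, 1, 0) + y + z ≠ (1, 0, 0) →
      d3 (A 0) (A (0, 1, 0)) (B y) = 0 ∧ d3 (A 0) (A (0, 1, 0)) (C z) = 0 := by
    intro y z x h0 h1 h2 h3 h4
    have hQ : cr (B y) (C z) ≠ 0 := by
      intro h
      apply N x y z h0
      have i0 := congrFun h 0
      have i1 := congrFun h 1
      have i2 := congrFun h 2
      simp [cr] at i0 i1 i2
      unfold d3
      linear_combination A x 0 * i0 + A x 1 * i1 + A x 2 * i2
    have k0 := K 0 y z (by simpa using h1) (by simpa using h2)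
    have k1 := K (0, 1, 0) y z h3 h4
    constructor
    · apply perp hQ
      · rw [← k0]; simp [cr, d3]; ring
      · rw [← k1]; simp [cr, d3]; ring
      · simp [cr]; ring
    · apply perp hQ
      · rw [← k0]; simp [cr, d3]; ring
      · rw [← k1]; simp [cr, d3]; ring
      · simp [cr]; ring
  have iB := (inc 0 (0, 0, 1) (0, 0, 1) (by decide) (by decide) (by decide) (by decide)
    (by decide)).1
  have iC := (inc (0, 0, 1) 0 (0, 0, 1) (by decide) (by decide) (by decide) (by decide)
    (by decide)).2
  have hP : cr (A 0) (A (0, 1, 0)) ≠ 0 := by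
    intro h
    apply N 0 0 0 (by decide)
    have hz : A (0, 1, 0) ≠ 0 := by
      intro h
      apply N (0, 1, 0) 0 (0, 1, 0) (by decide)
      rw [h]; simp [d3]
    have k := K (0, 1, 0) 0 0 (by decide) (by decide)
    have i0 := congrFun h 0
    have i1 := congrFun h 1
    have i2 := congrFun h 2
    simp [cr] at i0 i1 i2
    by_contra hne
    apply hz
    have j0 : d3 (A 0) (B 0) (C 0) * A (0, 1, 0) 0 = 0 := by
      unfold d3 at k ⊢
      linear_combination A 0 0 * k - i2 * (B 0 2 * C 0 0 - B 0 0 * C 0 2) + i1 * (B 0 0 * C 0 1 - B 0 1 * C 0 0)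
    have j1 : d3 (A 0) (B 0) (C 0) * A (0, 1, 0) 1 = 0 := by
      unfold d3 at k ⊢
      linear_combination A 0 1 * k + i2 * (B 0 1 * C 0 2 - B 0 2 * C 0 1) - i0 * (B 0 0 * C 0 1 - B 0 1 * C 0 0)
    have j2 : d3 (A 0) (B 0) (C 0) * A (0, 1, 0) 2 = 0 := by
      unfold d3 at k ⊢
      linear_combination A 0 2 * k - i1 * (B 0 1 * C 0 2 - B 0 2 * C 0 1) + i0 * (B 0 2 * C 0 0 - B 0 0 * C 0 2)
    ext i
    fin_cases i
    · exact (mul_eq_zero.1 j0).resolve_left hne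
    · exact (mul_eq_zero.1 j1).resolve_left hne
    · exact (mul_eq_zero.1 j2).resolve_left hne
  apply N 0 0 0 (by decide)
  apply perp hP
  · simp [cr]; ring
  · rw [← iB]; simp [cr, d3]; ring
  · rw [← iC]; simp [cr, d3]; ring

theorem collin_iff (p q r : P2) : Collin p q r ↔ d3 p.rep q.rep r.rep = 0 := by
  have hset : ({p.rep, q.rep, r.rep} : Set V3) = Set.range ![p.rep, q.rep, r.rep] := by
    simp only [Matrix.range_cons, Matrix.range_empty, Set.union_empty, Set.singleton_union]
  have hdet : d3 p.rep q.rep r.rep = (Matrix.of ![p.rep, q.rep, r.rep]).det := by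
    rw [Matrix.det_fin_three]; simp [d3]; ring
  have hli : LinearIndependent ℂ ![p.rep, q.rep, r.rep] ↔
      (Matrix.of ![p.rep, q.rep, r.rep]).det ≠ 0 := by
    rw [← isUnit_iff_ne_zero, ← Matrix.isUnit_iff_isUnit_det,
      ← Matrix.linearIndependent_rows_iff_isUnit]
    rfl
  rw [linearIndependent_iff_card_le_finrank_span, Fintype.card_fin] at hli
  unfold Collin
  rw [hset, hdet]
  unfold Set.finrank at hli
  constructor
  · intro h
    by_contra hn
    have := hli.2 hn
    omega
  · intro h
    by_contra hn
    exact hli.1 (by omega) h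

/-- The group (ℤ/2ℤ)³ cannot be realized by a 3-net in ℙ²(ℂ). -/
theorem no_realization_Z2_cubed :
    ¬ ∃ p₁ p₂ p₃ : (ZMod 2 × ZMod 2 × ZMod 2) → P2, Realizes p₁ p₂ p₃ := by
  rintro ⟨p₁, p₂, p₃, h⟩
  obtain ⟨-, -, -, -, -, -, h⟩ := h
  refine no_vectors (fun x => (p₁ x).rep) (fun x => (p₂ x).rep) (fun x => (p₃ x).rep) ?_
  intro x y z
  rw [← h x y z, collin_iff]
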